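/- arXiv:1109.6789 — 7 statements merged into one kernel-verified Lean document; each statement's English description precedes it below -/
import Mathlib

section
/- Let p, q, r be nonnegative integers with p + q + r = 2 and p + q ≥ 1, and let I_pqr be the 2×2 diagonal matrix whose diagonal consists of p entries equal to 1, followed by q entries equal to −1, followed by r entries equal to 0. Then H(I_pqr) = {e^s h : s ∈ ℝ, h ∈ GL(2,ℝ) with ᵀh I_pqr h = I_pqr or ᵀh I_pqr h = −I_pqr}, where H(I_pqr) = {h ∈ GL(2,ℝ) : ᵀh⁻¹ I_pqr h⁻¹ = λ I_pqr for some λ ∈ ℝ, λ ≠ 0}. -/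
open Matrix

noncomputable section

/-- The action `h†[σ] = ᵀh⁻¹ σ h⁻¹`. -/
def dag (h σ : Matrix (Fin 2) (Fin 2) ℝ) : Matrix (Fin 2) (Fin 2) ℝ :=
  h⁻¹ᵀ * σ * h⁻¹

/-- `H(σ) = {h ∈ GL(2,ℝ) : h†[σ] = λσ for some λ ≠ 0}`. -/
def Hgrp (σ : Matrix (Fin 2) (Fin 2) ℝ) : Set (Matrix (Fin 2) (Fin 2) ℝ) :=
  {h | IsUnit h ∧ ∃ l : ℝ, l ≠ 0 ∧ dag h σ = l • σ}

/-- The canonical metric of signature `(p, q, r)` as a `2 × 2` diagonal matrix: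
`p` ones, then `q` minus-ones, then `r` zeros on the diagonal. -/
def Ipqr (p q : ℕ) : Matrix (Fin 2) (Fin 2) ℝ :=
  Matrix.diagonal (fun i => if (i : ℕ) < p then 1 else if (i : ℕ) < p + q then -1 else 0)

theorem dag_iff (g σ : Matrix (Fin 2) (Fin 2) ℝ) (hg : IsUnit g) (l : ℝ) (hl : l ≠ 0) :
    dag g σ = l • σ ↔ gᵀ * σ * g = l⁻¹ • σ := by
  have hd : IsUnit g.det := (Matrix.isUnit_iff_isUnit_det g).1 hg
  have h1 : g⁻¹ * g = 1 := Matrix.nonsing_inv_mul g hd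
  have h2 : g * g⁻¹ = 1 := Matrix.mul_nonsing_inv g hd
  have h3 : gᵀ * g⁻¹ᵀ = 1 := by rw [← Matrix.transpose_mul, h1, Matrix.transpose_one]
  have h4 : g⁻¹ᵀ * gᵀ = 1 := by rw [← Matrix.transpose_mul, h2, Matrix.transpose_one]
  unfold dag
  constructor
  · intro h
    have h5 : gᵀ * (g⁻¹ᵀ * σ * g⁻¹) * g = σ := by
      calc gᵀ * (g⁻¹ᵀ * σ * g⁻¹) * g = (gᵀ * g⁻¹ᵀ) * σ * (g⁻¹ * g) := by
            simp only [Matrix.mul_assoc]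
        _ = σ := by rw [h1, h3, Matrix.one_mul, Matrix.mul_one]
    rw [h, Matrix.mul_smul, Matrix.smul_mul] at h5
    rw [eq_inv_smul_iff₀ hl, h5]
  · intro h
    have h5 : g⁻¹ᵀ * (gᵀ * σ * g) * g⁻¹ = σ := by
      calc g⁻¹ᵀ * (gᵀ * σ * g) * g⁻¹ = (g⁻¹ᵀ * gᵀ) * σ * (g * g⁻¹) := by
            simp only [Matrix.mul_assoc]
        _ = σ := by rw [h2, h4, Matrix.one_mul, Matrix.mul_one]
    rw [h, Matrix.mul_smul, Matrix.smul_mul] at h5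
    rwa [inv_smul_eq_iff₀ hl] at h5

theorem conj_smul (c : ℝ) (h σ : Matrix (Fin 2) (Fin 2) ℝ) :
    (c • h)ᵀ * σ * (c • h) = (c * c) • (hᵀ * σ * h) := by
  simp [Matrix.transpose_smul, Matrix.smul_mul, Matrix.mul_smul, smul_smul]

theorem isUnit_smul_exp (s : ℝ) (h : Matrix (Fin 2) (Fin 2) ℝ) (hh : IsUnit h) :
    IsUnit (Real.exp s • h) := by
  rw [Matrix.isUnit_iff_isUnit_det] at hh ⊢
  rw [Matrix.det_smul]
  exact (((Real.exp_ne_zero s).isUnit).pow _).mul hh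

theorem stmt5 (p q r : ℕ) (hpqr : p + q + r = 2) (hpq : 1 ≤ p + q) :
    Hgrp (Ipqr p q) =
      {g | ∃ (s : ℝ) (h : Matrix (Fin 2) (Fin 2) ℝ), IsUnit h ∧
        (hᵀ * Ipqr p q * h = Ipqr p q ∨ hᵀ * Ipqr p q * h = -(Ipqr p q)) ∧
        g = Real.exp s • h} := by
  ext g
  generalize Ipqr p q = σ
  simp only [Hgrp, Set.mem_setOf_eq]
  constructor
  · rintro ⟨hg, l, hl, h⟩
    rw [dag_iff g σ hg l hl] at h
    have hlp : 0 < |l| := abs_pos.2 hl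
    have hc : Real.exp (Real.log |l| / 2) * Real.exp (Real.log |l| / 2) = |l| := by
      rw [← Real.exp_add, add_halves, Real.exp_log hlp]
    refine ⟨-(Real.log |l| / 2), Real.exp (Real.log |l| / 2) • g,
      isUnit_smul_exp _ _ hg, ?_, ?_⟩
    · rw [conj_smul, h, hc, smul_smul]
      rcases abs_choice l with h' | h'
      · left; rw [h', mul_inv_cancel₀ hl, one_smul]
      · right; rw [h', neg_mul, mul_inv_cancel₀ hl, neg_smul, one_smul]
    · rw [smul_smul, ← Real.exp_add, neg_add_cancel, Real.exp_zero, one_smul]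
  · rintro ⟨s, h, hh, hor, rfl⟩
    have hu := isUnit_smul_exp s h hh
    have he : Real.exp s * Real.exp s ≠ 0 := by positivity
    refine ⟨hu, ?_⟩
    rcases hor with h' | h'
    · refine ⟨(Real.exp s * Real.exp s)⁻¹, inv_ne_zero he, ?_⟩
      rw [dag_iff _ _ hu _ (inv_ne_zero he), conj_smul, h', inv_inv]
    · refine ⟨(-(Real.exp s * Real.exp s))⁻¹, inv_ne_zero (neg_ne_zero.2 he), ?_⟩
      rw [dag_iff _ _ hu _ (inv_ne_zero (neg_ne_zero.2 he)), conj_smul, h', inv_inv,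
        smul_neg, neg_smul]
end
end

section
/- Let σ₃ = [[1,0],[0,0]]. Then H(σ₃) := {h ∈ GL(2,ℝ) : ᵀh⁻¹ σ₃ h⁻¹ = λσ₃ for some λ ∈ ℝ, λ ≠ 0} is exactly the group T of all invertible lower triangular real 2×2 matrices, i.e. H(σ₃) = {[[c,0],[b,a]] : a, b, c ∈ ℝ, ac ≠ 0}. -/
open Matrix

noncomputable section

/-- `σ₃ = [[1,0],[0,0]]`. -/
def sigma3 : Matrix (Fin 2) (Fin 2) ℝ := !![1, 0; 0, 0]

/-- The group `T` of invertible lower triangular real `2 × 2` matrices. -/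
def Tgrp : Set (Matrix (Fin 2) (Fin 2) ℝ) :=
  {m | ∃ a b c : ℝ, a * c ≠ 0 ∧ m = !![c, 0; b, a]}

theorem stmt6 : Hgrp sigma3 = Tgrp := by
  ext h
  constructor
  · rintro ⟨hu, l, hl, he⟩
    have hd : h.det ≠ 0 := ((Matrix.isUnit_iff_isUnit_det h).1 hu).ne_zero
    have h11 := congrFun (congrFun he 1) 1
    have h01 : h 0 1 = 0 := by
      simp [dag, sigma3, Matrix.inv_def, Matrix.adjugate_fin_two, Matrix.mul_apply,
        Fin.sum_univ_two, hd] at h11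
      exact h11
    refine ⟨h 1 1, h 1 0, h 0 0, ?_, ?_⟩
    · rw [Matrix.det_fin_two, h01] at hd
      intro h0
      apply hd
      linarith
    · rw [← h01]
      exact Matrix.eta_fin_two h
  · rintro ⟨a, b, c, hac, rfl⟩
    have ha : a ≠ 0 := left_ne_zero_of_mul hac
    have hc : c ≠ 0 := right_ne_zero_of_mul hac
    refine ⟨?_, (c⁻¹) ^ 2, by positivity, ?_⟩
    · rw [Matrix.isUnit_iff_isUnit_det, Matrix.det_fin_two_of]
      exact IsUnit.mk0 _ (by simpa using ⟨hc, ha⟩)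
    · ext i j
      fin_cases i <;> fin_cases j <;>
        simp [dag, sigma3, Matrix.inv_def, Matrix.adjugate_fin_two, Matrix.mul_apply,
          Fin.sum_univ_two, Matrix.det_fin_two_of]
      field_simp
end
end

section
/- Let J = [[0,1],[−1,0]], I = I₂, and let H(σ₁) = {h ∈ GL(2,ℝ) : ᵀh⁻¹ h⁻¹ = λI for some λ ∈ ℝ, λ ≠ 0}. For α ∈ ℝ let 𝔥_α = span{I + αJ} ⊆ M₂(ℝ) and let 𝔥_∞ = span{J}. Then: (a) for α₁, α₂ ∈ ℝ, there exists g ∈ H(σ₁) with g·𝔥_{α₁}·g⁻¹ = 𝔥_{α₂} if and only if α₁ = α₂ or α₁ = −α₂; (b) for no α ∈ ℝ and no g ∈ H(σ₁) does g·𝔥_∞·g⁻¹ = 𝔥_α hold. -/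
open Matrix

noncomputable section

/-- `J = [[0,1],[-1,0]]`. -/
def Jm : Matrix (Fin 2) (Fin 2) ℝ := !![0, 1; -1, 0]

/-- `H(σ₁)` where `σ₁ = I₂`: matrices `h` with `ᵀh⁻¹ h⁻¹` a nonzero scalar multiple of `I`. -/
def Hsigma1 : Set (Matrix (Fin 2) (Fin 2) ℝ) :=
  {h | IsUnit h ∧ ∃ l : ℝ, l ≠ 0 ∧ dag h 1 = l • (1 : Matrix (Fin 2) (Fin 2) ℝ)}

/-- Conjugation of a set of matrices: `g·S·g⁻¹`. -/
def conjSet (g : Matrix (Fin 2) (Fin 2) ℝ) (S : Set (Matrix (Fin 2) (Fin 2) ℝ)) :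
    Set (Matrix (Fin 2) (Fin 2) ℝ) :=
  (fun X => g * X * g⁻¹) '' S

/-- `𝔥_α = span{I + αJ}`. -/
def halg (α : ℝ) : Set (Matrix (Fin 2) (Fin 2) ℝ) :=
  (Submodule.span ℝ {(1 : Matrix (Fin 2) (Fin 2) ℝ) + α • Jm} :
    Submodule ℝ (Matrix (Fin 2) (Fin 2) ℝ))

/-- `𝔥_∞ = span{J}`. -/
def hinf : Set (Matrix (Fin 2) (Fin 2) ℝ) :=
  (Submodule.span ℝ {Jm} : Submodule ℝ (Matrix (Fin 2) (Fin 2) ℝ))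

theorem aux_inv (g X : Matrix (Fin 2) (Fin 2) ℝ) (hg : IsUnit g) :
    (g * X * g⁻¹).trace = X.trace ∧ (g * X * g⁻¹).det = X.det := by
  have hd : IsUnit g.det := (Matrix.isUnit_iff_isUnit_det g).1 hg
  constructor
  · rw [Matrix.trace_mul_comm, ← Matrix.mul_assoc, Matrix.nonsing_inv_mul g hd, Matrix.one_mul]
  · exact Matrix.det_conj hg X

theorem aux_tr (a : ℝ) : ((1 : Matrix (Fin 2) (Fin 2) ℝ) + a • Jm).trace = 2 := by
  simp [Jm, Matrix.trace_fin_two]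
  try norm_num

theorem aux_det (a : ℝ) : ((1 : Matrix (Fin 2) (Fin 2) ℝ) + a • Jm).det = 1 + a ^ 2 := by
  simp [Jm, Matrix.det_fin_two]
  try ring

theorem aux_mem (g X : Matrix (Fin 2) (Fin 2) ℝ) (hg : IsUnit g) (a : ℝ)
    (h : g * X * g⁻¹ ∈ halg a) : ∃ c : ℝ, X.trace = 2 * c ∧ X.det = c ^ 2 * (1 + a ^ 2) := by
  obtain ⟨c, hc⟩ := Submodule.mem_span_singleton.1 h
  obtain ⟨h1, h2⟩ := aux_inv g X hg
  rw [← hc, Matrix.trace_smul, aux_tr] at h1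
  rw [← hc, Matrix.det_smul, aux_det] at h2
  refine ⟨c, ?_, ?_⟩
  · rw [← h1, smul_eq_mul]; ring
  · rw [← h2]; simp

theorem stmt7 :
    -- (a)
    (∀ α₁ α₂ : ℝ,
      (∃ g ∈ Hsigma1, conjSet g (halg α₁) = halg α₂) ↔ (α₁ = α₂ ∨ α₁ = -α₂)) ∧
    -- (b)
    (∀ α : ℝ, ∀ g ∈ Hsigma1, conjSet g hinf ≠ halg α) := by
  refine ⟨fun a b => ⟨?_, ?_⟩, ?_⟩
  · rintro ⟨g, ⟨hg, -⟩, h⟩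
    have hm : g * (1 + a • Jm) * g⁻¹ ∈ halg b := by
      rw [← h]
      exact ⟨_, Submodule.mem_span_singleton_self _, rfl⟩
    obtain ⟨c, h1, h2⟩ := aux_mem g _ hg b hm
    rw [aux_tr] at h1
    rw [aux_det] at h2
    have hc : c = 1 := by linarith
    subst hc
    exact sq_eq_sq_iff_eq_or_eq_neg.1 (by linarith)
  · rintro (rfl | rfl)
    · refine ⟨1, ⟨isUnit_one, 1, one_ne_zero, ?_⟩, ?_⟩
      · simp [dag]
      · simp [conjSet]
    · have hDD : (!![1, 0; 0, -1] : Matrix (Fin 2) (Fin 2) ℝ) * !![1, 0; 0, -1] = 1 := by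
        simp [Matrix.one_fin_two]
      have hinv : (!![1, 0; 0, -1] : Matrix (Fin 2) (Fin 2) ℝ)⁻¹ = !![1, 0; 0, -1] :=
        Matrix.inv_eq_left_inv hDD
      have hconj : ∀ t : ℝ, (!![1, 0; 0, -1] : Matrix (Fin 2) (Fin 2) ℝ) * (t • (1 + -b • Jm))
          * !![1, 0; 0, -1] = t • (1 + b • Jm) := by
        intro t
        ext i j
        fin_cases i <;> fin_cases j <;> simp [Jm, Matrix.one_fin_two]
      refine ⟨!![1, 0; 0, -1], ⟨IsUnit.of_mul_eq_one _ hDD, 1, one_ne_zero, ?_⟩, ?_⟩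
      · rw [dag, hinv]
        ext i j
        fin_cases i <;> fin_cases j <;> simp [Matrix.mul_apply, Fin.sum_univ_two]
      · ext Y
        constructor
        · rintro ⟨X, hX, rfl⟩
          obtain ⟨t, rfl⟩ := Submodule.mem_span_singleton.1 hX
          refine Submodule.mem_span_singleton.2 ⟨t, ?_⟩
          simp only [hinv]
          exact (hconj t).symm
        · intro hY
          obtain ⟨t, rfl⟩ := Submodule.mem_span_singleton.1 hY
          refine ⟨t • (1 + -b • Jm), Submodule.mem_span_singleton.2 ⟨t, rfl⟩, ?_⟩
          simp only [hinv]
          exact hconj t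
  · rintro a g ⟨hg, -⟩ h
    have hm : g * Jm * g⁻¹ ∈ halg a := by
      rw [← h]
      exact ⟨_, Submodule.mem_span_singleton_self _, rfl⟩
    obtain ⟨c, h1, h2⟩ := aux_mem g _ hg a hm
    have hc : c = 0 := by
      simp [Jm, Matrix.trace_fin_two] at h1
      exact h1
    subst hc
    simp [Jm, Matrix.det_fin_two] at h2
end
end

section
/- Let σ₀ = [[c,b],[b,0]] be a nonzero real symmetric 2×2 matrix (i.e. σ₀ is trace-orthogonal to σ₄ = [[0,0],[0,1]]), and let Σ = span{σ₀}. Then: (i) if b ≠ 0 (i.e. σ₀ has signature (1,1,0)), there exists an invertible lower triangular matrix t ∈ T such that t†[Σ] = span{σ₅}, where σ₅ = [[0,1],[1,0]]; (ii) if b = 0 (so c ≠ 0, i.e. σ₀ has signature (1,0,1)), there exists t ∈ T such that t†[Σ] = span{σ₃}, where σ₃ = [[1,0],[0,0]]. -/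
open Matrix

noncomputable section

/-- `σ₅ = [[0,1],[1,0]]`. -/
def sigma5 : Matrix (Fin 2) (Fin 2) ℝ := !![0, 1; 1, 0]

theorem dag_span_aux (t σ τ : Matrix (Fin 2) (Fin 2) ℝ) (k : ℝ) (hk : k ≠ 0)
    (h : dag t σ = k • τ) :
    dag t '' (Submodule.span ℝ {σ} : Submodule ℝ (Matrix (Fin 2) (Fin 2) ℝ)) =
      (Submodule.span ℝ {τ} : Submodule ℝ (Matrix (Fin 2) (Fin 2) ℝ)) := by
  have hs : ∀ r : ℝ, dag t (r • σ) = (r * k) • τ := by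
    intro r
    rw [mul_smul, ← h]
    simp [dag]
  ext x
  simp only [Set.mem_image, SetLike.mem_coe, Submodule.mem_span_singleton]
  constructor
  · rintro ⟨_, ⟨r, rfl⟩, rfl⟩
    exact ⟨r * k, (hs r).symm⟩
  · rintro ⟨r, rfl⟩
    refine ⟨_, ⟨r / k, rfl⟩, ?_⟩
    rw [hs, div_mul_cancel₀ _ hk]

theorem stmt12 (c b : ℝ) (hne : !![c, b; b, 0] ≠ (0 : Matrix (Fin 2) (Fin 2) ℝ)) :
    -- (i) signature (1,1,0)
    (b ≠ 0 → ∃ t ∈ Tgrp,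
      dag t '' (Submodule.span ℝ {!![c, b; b, (0 : ℝ)]} :
        Submodule ℝ (Matrix (Fin 2) (Fin 2) ℝ)) =
      (Submodule.span ℝ {sigma5} : Submodule ℝ (Matrix (Fin 2) (Fin 2) ℝ))) ∧
    -- (ii) signature (1,0,1)
    (b = 0 → ∃ t ∈ Tgrp,
      dag t '' (Submodule.span ℝ {!![c, b; b, (0 : ℝ)]} :
        Submodule ℝ (Matrix (Fin 2) (Fin 2) ℝ)) =
      (Submodule.span ℝ {sigma3} : Submodule ℝ (Matrix (Fin 2) (Fin 2) ℝ))) := by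
  constructor
  · intro hb
    refine ⟨!![1, 0; c / (2 * b), 1], ⟨1, c / (2 * b), 1, by norm_num, rfl⟩, ?_⟩
    apply dag_span_aux _ _ _ b hb
    have hi : (!![1, 0; c / (2 * b), 1] : Matrix (Fin 2) (Fin 2) ℝ)⁻¹
        = !![1, 0; -(c / (2 * b)), 1] := by
      apply Matrix.inv_eq_right_inv
      ext i j
      fin_cases i <;> fin_cases j <;> simp [Matrix.mul_apply, Fin.sum_univ_two]
    rw [dag, hi]
    ext i j
    fin_cases i <;> fin_cases j <;>
      simp [Matrix.mul_apply, Fin.sum_univ_two, sigma5]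
    field_simp
    ring
  · intro hb
    subst hb
    have hc : c ≠ 0 := by
      rintro rfl
      apply hne
      ext i j
      fin_cases i <;> fin_cases j <;> simp
    refine ⟨1, ⟨1, 0, 1, by norm_num, Matrix.one_fin_two⟩, ?_⟩
    apply dag_span_aux _ _ _ c hc
    ext i j
    fin_cases i <;> fin_cases j <;> simp [dag, sigma3]
end
end

section
/- Let Σ₃ = {[[x,0],[0,0]] : x ∈ ℝ}, Σ₃⊥ = {[[0,v],[v,u]] : u,v ∈ ℝ}, let T⁰ = {[[c,0],[b,a]] : a > 0, c > 0, b ∈ ℝ} be the identity component of the lower triangular group, and let K₀(σ₃) = {[[e^t,0],[0,e^s]] : s,t ∈ ℝ} be the group of positive diagonal matrices. Then the subgroups Σ₃⋊T⁰ and Σ₃⊥⋊K₀(σ₃) of Sp(2,ℝ) are conjugate: there exists g ∈ Sp(2,ℝ) with g·(Σ₃⋊T⁰)·g⁻¹ = Σ₃⊥⋊K₀(σ₃). -/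
open Matrix

noncomputable section

abbrev M2 := Matrix (Fin 2) (Fin 2) ℝ
abbrev M4 := Matrix (Fin 2 ⊕ Fin 2) (Fin 2 ⊕ Fin 2) ℝ

/-- The standard symplectic form `J = [[0, I₂], [-I₂, 0]]`. -/
def Jmat : M4 := fromBlocks 0 1 (-1) 0

/-- The symplectic group `Sp(2, ℝ)` as a set of `4 × 4` matrices. -/
def SpSet : Set M4 := {g | gᵀ * Jmat * g = Jmat}

/-- The block matrix `g(σ, h) = [[h, 0], [σh, ᵀh⁻¹]]`. -/
def gmat (σ h : M2) : M4 := fromBlocks h 0 (σ * h) h⁻¹ᵀ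

/-- The semidirect product set `Σ ⋊ H = {g(σ, h) : σ ∈ Σ, h ∈ H}`. -/
def sdp (S H : Set M2) : Set M4 := {g | ∃ σ ∈ S, ∃ h ∈ H, g = gmat σ h}

/-- Conjugation of a set of `4 × 4` matrices: `g·S·g⁻¹`. -/
def conj4 (g : M4) (S : Set M4) : Set M4 := (fun x => g * x * g⁻¹) '' S

/-- `Σ₃ = {[[x,0],[0,0]] : x ∈ ℝ}`. -/
def Sigma3 : Set M2 := {m | ∃ x : ℝ, m = !![x, 0; 0, 0]}

/-- `Σ₃⊥ = {[[0,v],[v,u]] : u, v ∈ ℝ}`. -/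
def Sigma3perp : Set M2 := {m | ∃ u v : ℝ, m = !![0, v; v, u]}

/-- `T⁰`, the identity component of the lower triangular group. -/
def T0 : Set M2 := {m | ∃ a b c : ℝ, 0 < a ∧ 0 < c ∧ m = !![c, 0; b, a]}

/-- `K₀(σ₃)`, the group of positive diagonal matrices. -/
def K0 : Set M2 := {m | ∃ s t : ℝ, m = !![Real.exp t, 0; 0, Real.exp s]}

def gC : M4 :=
  fromBlocks !![0, 0; 1, 0] !![0, 1; 0, 0] !![0, -1; 0, 0] !![0, 0; 1, 0]

lemma gC_mul : gC * gCᵀ = 1 := by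
  ext i j
  rcases i with i | i <;> rcases j with j | j <;> fin_cases i <;> fin_cases j <;>
    simp [gC, Matrix.mul_apply, Fin.sum_univ_two]

lemma gC_inv : gC⁻¹ = gCᵀ := Matrix.inv_eq_right_inv gC_mul

lemma gC_sp : gC ∈ SpSet := by
  show gCᵀ * Jmat * gC = Jmat
  ext i j
  rcases i with i | i <;> rcases j with j | j <;> fin_cases i <;> fin_cases j <;>
    simp [gC, Jmat, Matrix.mul_apply, Fin.sum_univ_two]

lemma tri_inv (a b c : ℝ) (ha : a ≠ 0) (hc : c ≠ 0) :
    (!![c, 0; b, a] : M2)⁻¹ = !![c⁻¹, 0; -b / (a * c), a⁻¹] := by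
  apply Matrix.inv_eq_right_inv
  ext i j
  fin_cases i <;> fin_cases j <;> simp [Matrix.mul_apply, Fin.sum_univ_two, ha, hc]
  field_simp
  ring

lemma key (a b c x : ℝ) (ha : a ≠ 0) (hc : c ≠ 0) :
    gC * gmat !![x, 0; 0, 0] !![c, 0; b, a] * gC⁻¹ =
      gmat !![0, -b / c; -b / c, x] !![a⁻¹, 0; 0, c] := by
  have hi : (!![a⁻¹, 0; 0, c] : M2)⁻¹ = !![a, 0; 0, c⁻¹] := by
    rw [tri_inv c 0 a⁻¹ hc (inv_ne_zero ha)]; simp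
  rw [gC_inv, gmat, gmat, tri_inv a b c ha hc, hi]
  ext i j
  rcases i with i | i <;> rcases j with j | j <;> fin_cases i <;> fin_cases j <;>
    simp [gC, Matrix.mul_apply, Fin.sum_univ_two] <;> field_simp

theorem stmt14 : ∃ g ∈ SpSet, conj4 g (sdp Sigma3 T0) = sdp Sigma3perp K0 := by
  refine ⟨gC, gC_sp, ?_⟩
  ext m
  constructor
  · rintro ⟨_, ⟨_, ⟨x, rfl⟩, _, ⟨a, b, c, ha, hc, rfl⟩, rfl⟩, rfl⟩
    refine ⟨_, ⟨x, -b / c, rfl⟩, _, ⟨Real.log c, Real.log a⁻¹, rfl⟩, ?_⟩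
    rw [Real.exp_log hc, Real.exp_log (inv_pos.mpr ha)]
    exact key a b c x ha.ne' hc.ne'
  · rintro ⟨_, ⟨u, v, rfl⟩, _, ⟨s, t, rfl⟩, rfl⟩
    refine ⟨_, ⟨_, ⟨u, rfl⟩, _, ⟨(Real.exp t)⁻¹, -v * Real.exp s, Real.exp s,
      inv_pos.mpr (Real.exp_pos t), Real.exp_pos s, rfl⟩, rfl⟩, ?_⟩
    have hs := (Real.exp_pos s).ne'
    have e : -(-v * Real.exp s) / Real.exp s = v := by field_simp
    have := key (Real.exp t)⁻¹ (-v * Real.exp s) (Real.exp s) u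
      (inv_ne_zero (Real.exp_pos t).ne') hs
    rw [e, inv_inv] at this
    exact this
end
end

section
/- Let Σ₃ = {[[x,0],[0,0]] : x ∈ ℝ}, let H_∞(σ₃) = {e^t I₂ : t ∈ ℝ} be the group of positive scalar matrices, and let H_{−1/2,0}(σ₃) = {[[e^{−t/2},0],[0,e^{t/2}]] : t ∈ ℝ}. Then the subgroups Σ₃⋊H_∞(σ₃) and Σ₃⋊H_{−1/2,0}(σ₃) of Sp(2,ℝ) are conjugate: there exists g ∈ Sp(2,ℝ) with g·(Σ₃⋊H_∞(σ₃))·g⁻¹ = Σ₃⋊H_{−1/2,0}(σ₃). -/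
open Matrix

noncomputable section

/-- `H_∞(σ₃) = {e^t I₂ : t ∈ ℝ}`, the group of positive scalar matrices. -/
def Hinf : Set M2 := {m | ∃ t : ℝ, m = Real.exp t • (1 : M2)}

/-- `H_{−1/2,0}(σ₃) = {[[e^{−t/2},0],[0,e^{t/2}]] : t ∈ ℝ}`. -/
def Hhalf : Set M2 := {m | ∃ t : ℝ, m = !![Real.exp (-t / 2), 0; 0, Real.exp (t / 2)]}

def gW : M4 := fromBlocks !![1, 0; 0, 0] !![0, 0; 0, 1] !![0, 0; 0, -1] !![1, 0; 0, 0]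

def gV : M4 := fromBlocks !![1, 0; 0, 0] !![0, 0; 0, -1] !![0, 0; 0, 1] !![1, 0; 0, 0]

lemma gW_inv : gW⁻¹ = gV := by
  apply Matrix.inv_eq_right_inv
  unfold gW gV
  rw [fromBlocks_multiply, ← fromBlocks_one]
  congr 1 <;> ext i j <;> fin_cases i <;> fin_cases j <;> simp [Matrix.mul_apply]

lemma inv_diag2 (a b : ℝ) (ha : a ≠ 0) (hb : b ≠ 0) :
    (!![a, 0; 0, b] : M2)⁻¹ = !![a⁻¹, 0; 0, b⁻¹] := by
  apply Matrix.inv_eq_right_inv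
  ext i j
  fin_cases i <;> fin_cases j <;> simp [ha, hb]

lemma key_s15 (x t : ℝ) :
    gW * gmat !![x, 0; 0, 0] (Real.exp (-t / 2) • (1 : M2)) * gW⁻¹
      = gmat !![x, 0; 0, 0] !![Real.exp (-t / 2), 0; 0, Real.exp (t / 2)] := by
  have h1 : (Real.exp (-t / 2) • (1 : M2)) = !![Real.exp (-t / 2), 0; 0, Real.exp (-t / 2)] := by
    ext i j
    fin_cases i <;> fin_cases j <;> simp
  have h2 : Real.exp (-t / 2) = (Real.exp (t / 2))⁻¹ := by
    rw [← Real.exp_neg]; ring_nf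
  have hp : Real.exp (t / 2) ≠ 0 := Real.exp_ne_zero _
  rw [gW_inv, h1, h2]
  generalize Real.exp (t / 2) = a at hp
  unfold gmat gW gV
  rw [inv_diag2 _ _ (inv_ne_zero hp) (inv_ne_zero hp), inv_diag2 _ _ (inv_ne_zero hp) hp,
    fromBlocks_multiply, fromBlocks_multiply]
  congr 1 <;> ext i j <;> fin_cases i <;> fin_cases j <;>
    simp [Matrix.vecMul, dotProduct, Matrix.mul_apply, Fin.sum_univ_two]

theorem stmt15 : ∃ g ∈ SpSet, conj4 g (sdp Sigma3 Hinf) = sdp Sigma3 Hhalf := by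
  refine ⟨gW, ?_, ?_⟩
  · show gWᵀ * Jmat * gW = Jmat
    unfold gW Jmat
    rw [fromBlocks_transpose, fromBlocks_multiply, fromBlocks_multiply]
    congr 1 <;> ext i j <;> fin_cases i <;> fin_cases j <;> simp [Matrix.mul_apply]
  · ext m
    constructor
    · rintro ⟨_, ⟨_, ⟨x, rfl⟩, _, ⟨t, rfl⟩, rfl⟩, rfl⟩
      refine ⟨_, ⟨x, rfl⟩, _, ⟨-2 * t, rfl⟩, ?_⟩
      rw [← key_s15]
      have : -(-2 * t) / 2 = t := by ring
      rw [this]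
    · rintro ⟨_, ⟨x, rfl⟩, _, ⟨t, rfl⟩, rfl⟩
      exact ⟨_, ⟨_, ⟨x, rfl⟩, _, ⟨-t / 2, rfl⟩, rfl⟩, key_s15 x t⟩
end
end

section
/- Let Σ₃ = {[[x,0],[0,0]] : x ∈ ℝ} and, for γ ∈ ℝ, let H_{γ,0}(σ₃) = {[[e^{γt},0],[0,e^{(γ+1)t}]] : t ∈ ℝ}. Then for every γ ∈ ℝ with γ ≠ −1/2, the subgroups Σ₃⋊H_{γ,0}(σ₃) and Σ₃⋊H_{−γ/(2γ+1),0}(σ₃) of Sp(2,ℝ) are conjugate: there exists g ∈ Sp(2,ℝ) with g·(Σ₃⋊H_{γ,0}(σ₃))·g⁻¹ = Σ₃⋊H_{−γ/(2γ+1),0}(σ₃). -/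
open Matrix

noncomputable section

/-- `H_{γ,0}(σ₃) = {[[e^{γt},0],[0,e^{(γ+1)t}]] : t ∈ ℝ}`. -/
def Hgam (γ : ℝ) : Set M2 :=
  {m | ∃ t : ℝ, m = !![Real.exp (γ * t), 0; 0, Real.exp ((γ + 1) * t)]}

def wmat : M4 := fromBlocks !![1,0;0,0] !![0,0;0,1] !![0,0;0,-1] !![1,0;0,0]
def wmat' : M4 := fromBlocks !![1,0;0,0] !![0,0;0,-1] !![0,0;0,1] !![1,0;0,0]

lemma wmat_mul : wmat * wmat' = 1 := by
  ext i j
  rcases i with i | i <;> rcases j with j | j <;> fin_cases i <;> fin_cases j <;>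
    simp [wmat, wmat', fromBlocks_multiply, Matrix.one_apply]

lemma wmat_inv : wmat⁻¹ = wmat' := Matrix.inv_eq_right_inv wmat_mul

lemma wmat_mem : wmat ∈ SpSet := by
  show _ = _
  ext i j
  rcases i with i | i <;> rcases j with j | j <;> fin_cases i <;> fin_cases j <;>
    simp [wmat, Jmat, fromBlocks_multiply, fromBlocks_transpose, Matrix.one_apply, Matrix.mul_apply,
      Fin.sum_univ_two]

lemma diag_inv (a b : ℝ) : (!![Real.exp a, 0; 0, Real.exp b])⁻¹
    = !![Real.exp (-a), 0; 0, Real.exp (-b)] := by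
  apply Matrix.inv_eq_right_inv
  ext i j
  fin_cases i <;> fin_cases j <;> simp [Matrix.mul_apply, ← Real.exp_add]

lemma conj_eq (x a b : ℝ) :
    wmat * gmat !![x, 0; 0, 0] !![Real.exp a, 0; 0, Real.exp b] * wmat⁻¹
      = gmat !![x, 0; 0, 0] !![Real.exp a, 0; 0, Real.exp (-b)] := by
  rw [wmat_inv]
  unfold gmat
  rw [diag_inv, diag_inv]
  ext i j
  rcases i with i | i <;> rcases j with j | j <;> fin_cases i <;> fin_cases j <;>
    simp [wmat, wmat', fromBlocks_multiply, Matrix.vecMul, dotProduct, Matrix.mul_apply, Fin.sum_univ_two]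

theorem stmt16 (γ : ℝ) (hγ : γ ≠ -1/2) :
    ∃ g ∈ SpSet, conj4 g (sdp Sigma3 (Hgam γ)) = sdp Sigma3 (Hgam (-γ / (2 * γ + 1))) := by
  have h0 : 2 * γ + 1 ≠ 0 := fun h => hγ (by linarith)
  have h1 : γ * 2 + 1 ≠ 0 := fun h => hγ (by linarith)
  refine ⟨wmat, wmat_mem, ?_⟩
  ext m
  constructor
  · rintro ⟨_, ⟨_, ⟨x, rfl⟩, _, ⟨t, rfl⟩, rfl⟩, rfl⟩
    refine ⟨_, ⟨x, rfl⟩, _, ⟨-(2 * γ + 1) * t, rfl⟩, ?_⟩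
    have e1 : -γ / (2 * γ + 1) * (-(2 * γ + 1) * t) = γ * t := by field_simp
    have e2 : (-γ / (2 * γ + 1) + 1) * (-(2 * γ + 1) * t) = -((γ + 1) * t) := by
      field_simp; ring
    rw [e1, e2]
    exact conj_eq x _ _
  · rintro ⟨_, ⟨x, rfl⟩, _, ⟨s, rfl⟩, rfl⟩
    refine ⟨_, ⟨_, ⟨x, rfl⟩, _, ⟨-s / (2 * γ + 1), rfl⟩, rfl⟩, ?_⟩
    have e1 : -γ / (2 * γ + 1) * s = γ * (-s / (2 * γ + 1)) := by field_simp
    have e2 : (-γ / (2 * γ + 1) + 1) * s = -((γ + 1) * (-s / (2 * γ + 1))) := by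
      field_simp; ring
    rw [e1, e2]
    exact conj_eq x _ _
end
end
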